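/- Let c_P(t) = Σ_{i=0}^n b_{i,n}(t) p_i be a Bézier curve of degree n with control points p_0, …, p_n ∈ ℝ^d and let c_Q(t) = Σ_{j=0}^m b_{j,m}(t) q_j be a Bézier curve of degree m with control points q_0, …, q_m ∈ ℝ^d. Then ∫₀¹ ⟨c_P(t), c_Q(t)⟩ dt = Σ_{i=0}^n Σ_{j=0}^m (1/(m+n+1)) · (C(n,i)·C(m,j))/C(m+n, i+j) · ⟨p_i, q_j⟩, where ⟨·,·⟩ is the Euclidean inner product on ℝ^d. -/

import Mathlib

open scoped RealInnerProductSpace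

/-- The Bernstein basis polynomial `b_{i,n}(t) = C(n,i) tⁱ (1-t)^{n-i}`. -/
noncomputable def bern (n i : ℕ) (t : ℝ) : ℝ :=
  (n.choose i : ℝ) * t ^ i * (1 - t) ^ (n - i)

/-- The Bézier curve of degree `n` with control points `p 0, …, p n` in `ℝ^d`. -/
noncomputable def bezier (d n : ℕ) (p : ℕ → EuclideanSpace ℝ (Fin d)) (t : ℝ) :
    EuclideanSpace ℝ (Fin d) :=
  ∑ i ∈ Finset.range (n + 1), bern n i t • p i

theorem integral_pow_mul_one_sub_pow (a b : ℕ) :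
    ∫ t in (0:ℝ)..1, t ^ a * (1 - t) ^ b =
      (a.factorial : ℝ) * b.factorial / (a + b + 1).factorial := by
  induction b generalizing a with
  | zero =>
    have ha : ((a.factorial : ℕ) : ℝ) ≠ 0 := by positivity
    simp [Nat.factorial_succ]
    field_simp
  | succ b ih =>
    have hderiv : ∀ t ∈ Set.uIcc (0:ℝ) 1,
        HasDerivAt (fun t : ℝ => t ^ (a + 1) * (1 - t) ^ (b + 1))
          (((a : ℝ) + 1) * (t ^ a * (1 - t) ^ (b + 1)) -
            ((b : ℝ) + 1) * (t ^ (a + 1) * (1 - t) ^ b)) t := by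
      intro t _
      have h := (hasDerivAt_pow (a + 1) t).mul (((hasDerivAt_id t).const_sub 1).pow (b + 1))
      refine h.congr_deriv ?_
      simp
      ring
    have hzero := intervalIntegral.integral_eq_sub_of_hasDerivAt hderiv
      (Continuous.intervalIntegrable (by fun_prop) _ _)
    rw [intervalIntegral.integral_sub (Continuous.intervalIntegrable (by fun_prop) _ _)
      (Continuous.intervalIntegrable (by fun_prop) _ _),
      intervalIntegral.integral_const_mul, intervalIntegral.integral_const_mul, ih (a + 1),
      show a + 1 + b + 1 = a + (b + 1) + 1 by ring] at hzero
    simp only [Nat.factorial_succ a, Nat.factorial_succ b] at hzero ⊢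
    push_cast at hzero ⊢
    have ha : (a : ℝ) + 1 ≠ 0 := by positivity
    apply mul_left_cancel₀ ha
    simp at hzero
    linear_combination hzero

theorem integral_bern_mul_bern {n m i j : ℕ} (hi : i ≤ n) (hj : j ≤ m) :
    ∫ t in (0:ℝ)..1, bern n i t * bern m j t =
      (1 / ((m : ℝ) + n + 1)) * ((n.choose i : ℝ) * (m.choose j : ℝ)) /
        ((m + n).choose (i + j) : ℝ) := by
  have hprod : ∀ t : ℝ, bern n i t * bern m j t =
      ((n.choose i : ℝ) * m.choose j) * (t ^ (i + j) * (1 - t) ^ (m + n - (i + j))) := by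
    intro t
    rw [show m + n - (i + j) = (n - i) + (m - j) by omega, bern, bern]
    ring
  have hle : i + j ≤ m + n := by omega
  simp only [hprod]
  rw [intervalIntegral.integral_const_mul, integral_pow_mul_one_sub_pow,
    Nat.add_sub_cancel' hle, Nat.cast_choose ℝ hle, Nat.factorial_succ]
  push_cast
  field_simp

theorem continuous_bern (n i : ℕ) : Continuous (bern n i) := by
  unfold bern
  fun_prop

/-- Bézier inner product: the integral of the inner product of two Bézier curves is
a quadratic form in their control points. -/
theorem bezier_inner_product (d n m : ℕ)
    (p q : ℕ → EuclideanSpace ℝ (Fin d)) :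
    ∫ t in (0:ℝ)..1, ⟪bezier d n p t, bezier d m q t⟫ =
      ∑ i ∈ Finset.range (n + 1), ∑ j ∈ Finset.range (m + 1),
        (1 / ((m : ℝ) + n + 1)) * ((n.choose i : ℝ) * (m.choose j : ℝ)) /
          ((m + n).choose (i + j) : ℝ) * ⟪p i, q j⟫ := by
  have hexpand : ∀ t : ℝ, ⟪bezier d n p t, bezier d m q t⟫ =
      ∑ i ∈ Finset.range (n + 1), ∑ j ∈ Finset.range (m + 1),
        bern n i t * bern m j t * ⟪p i, q j⟫ := by
    intro t
    simp only [bezier, sum_inner, inner_sum, real_inner_smul_left, real_inner_smul_right,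
      mul_assoc]
    rw [Finset.sum_comm]
    exact Finset.sum_congr rfl fun i _ => Finset.sum_congr rfl fun j _ => by ring
  have hcont : ∀ i j, Continuous fun t => bern n i t * bern m j t * ⟪p i, q j⟫ := fun i j =>
    ((continuous_bern n i).mul (continuous_bern m j)).mul continuous_const
  simp only [hexpand]
  rw [intervalIntegral.integral_finsetSum fun i _ =>
    (continuous_finsetSum _ fun j _ => hcont i j).intervalIntegrable _ _]
  refine Finset.sum_congr rfl fun i hi => ?_
  rw [intervalIntegral.integral_finsetSum fun j _ => (hcont i j).intervalIntegrable _ _]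
  refine Finset.sum_congr rfl fun j hj => ?_
  rw [intervalIntegral.integral_mul_const, integral_bern_mul_bern
    (Finset.mem_range_succ_iff.mp hi) (Finset.mem_range_succ_iff.mp hj)]
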